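/- arXiv:1908.00063 — 2 statements merged into one kernel-verified Lean document; each statement's English description precedes it below -/
import Mathlib

section
/- Let M, M' ∈ ℝ^{n×n} be ultra matrices and for λ ∈ [0,1] set M^λ = (1−λ)M + λM'. Then each M^λ is a valid matrix, Ũ(M^0) = M, Ũ(M^1) = M', and for all 0 ≤ λ ≤ μ ≤ 1, ‖Ũ(M^λ) − Ũ(M^μ)‖_∞ = (μ−λ)·‖M − M'‖_∞. That is, the family λ ↦ Ũ(M^λ) is a geodesic from M to M' in the space of ultra matrices with the sup distance (equivalently, in the space of labeled merge trees with the labeled interleaving distance). -/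
/-- A matrix is *valid* if it is symmetric and each diagonal entry is a
minimum of its row. -/
def IsValid {n : ℕ} (M : Fin n → Fin n → ℝ) : Prop :=
  (∀ i j, M i j = M j i) ∧ (∀ i j, M i i ≤ M i j)

/-- A matrix is *ultra* if it is valid and satisfies the ultrametric-type
inequality `M i j ≤ max (M i k) (M k j)`. -/
def IsUltra {n : ℕ} (M : Fin n → Fin n → ℝ) : Prop :=
  IsValid M ∧ ∀ i j k, M i j ≤ max (M i k) (M k j)

/-- The value of a path `v 0, …, v k`: the maximum of the edge weights
`M (v l) (v (l+1))` together with the diagonal entries at the two endpoints. -/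
def pathVal {n : ℕ} (M : Fin n → Fin n → ℝ) {k : ℕ} (v : Fin (k + 1) → Fin n) : ℝ :=
  Finset.univ.fold max
    (max (M (v 0) (v 0)) (M (v (Fin.last k)) (v (Fin.last k))))
    (fun l : Fin k => M (v l.castSucc) (v l.succ))

/-- The ultra-fication `Ũ(M)`: entry `(i,j)` is the minimax path value
over all finite paths from `i` to `j` in the complete graph with edge
weights `M u v` (the diagonal entries `M i i`, `M j j` always participate
in the max). -/
noncomputable def ultraFy {n : ℕ} (M : Fin n → Fin n → ℝ) : Fin n → Fin n → ℝ :=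
  fun i j => sInf { x | ∃ (k : ℕ) (v : Fin (k + 1) → Fin n),
    v 0 = i ∧ v (Fin.last k) = j ∧ x = pathVal M v }

/-- The entrywise sup distance `‖A - B‖_∞`. -/
noncomputable def supDist {n : ℕ} (A B : Fin n → Fin n → ℝ) : ℝ :=
  sSup { x | ∃ i j, x = |A i j - B i j| }

theorem pathVal_le_iff {n : ℕ} (M : Fin n → Fin n → ℝ) {k : ℕ} (v : Fin (k + 1) → Fin n)
    (c : ℝ) :
    pathVal M v ≤ c ↔ (M (v 0) (v 0) ≤ c ∧ M (v (Fin.last k)) (v (Fin.last k)) ≤ c) ∧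
      ∀ l : Fin k, M (v l.castSucc) (v l.succ) ≤ c := by
  simp [pathVal, Finset.fold_max_le]

theorem pathVal_le_add {n : ℕ} {A B : Fin n → Fin n → ℝ} {c : ℝ}
    (h : ∀ i j, A i j ≤ B i j + c) {k : ℕ} (v : Fin (k + 1) → Fin n) :
    pathVal A v ≤ pathVal B v + c := by
  obtain ⟨⟨h0, hk⟩, he⟩ := (pathVal_le_iff B v _).1 le_rfl
  refine (pathVal_le_iff A v _).2 ⟨⟨?_, ?_⟩, fun l => ?_⟩
  · exact (h _ _).trans (by gcongr)
  · exact (h _ _).trans (by gcongr)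
  · exact (h _ _).trans (by gcongr; exact he l)

theorem ultraFy_le_pathVal {n : ℕ} (M : Fin n → Fin n → ℝ) {k : ℕ}
    (v : Fin (k + 1) → Fin n) : ultraFy M (v 0) (v (Fin.last k)) ≤ pathVal M v := by
  refine csInf_le ⟨M (v 0) (v 0), ?_⟩ ⟨k, v, rfl, rfl, rfl⟩
  rintro _ ⟨m, w, hw, -, rfl⟩
  simpa only [hw] using ((pathVal_le_iff M w _).1 le_rfl).1.1

theorem le_ultraFy {n : ℕ} (M : Fin n → Fin n → ℝ) (i j : Fin n) {c : ℝ}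
    (h : ∀ (k : ℕ) (v : Fin (k + 1) → Fin n), v 0 = i → v (Fin.last k) = j → c ≤ pathVal M v) :
    c ≤ ultraFy M i j := by
  refine le_csInf ⟨_, 1, ![i, j], rfl, rfl, rfl⟩ ?_
  rintro _ ⟨k, v, h0, hk, rfl⟩
  exact h k v h0 hk

theorem ultraFy_le_add {n : ℕ} {A B : Fin n → Fin n → ℝ} {c : ℝ}
    (h : ∀ i j, A i j ≤ B i j + c) (i j : Fin n) : ultraFy A i j ≤ ultraFy B i j + c := by
  rw [← sub_le_iff_le_add]
  refine le_ultraFy B i j ?_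
  rintro k v rfl rfl
  rw [sub_le_iff_le_add]
  exact (ultraFy_le_pathVal A v).trans (pathVal_le_add h v)

theorem IsUltra.le_pathVal {n : ℕ} {M : Fin n → Fin n → ℝ} (hM : IsUltra M) {k : ℕ}
    (v : Fin (k + 1) → Fin n) : M (v 0) (v (Fin.last k)) ≤ pathVal M v := by
  obtain ⟨⟨h0, -⟩, he⟩ := (pathVal_le_iff M v _).1 le_rfl
  have key : ∀ m : Fin (k + 1), M (v 0) (v m) ≤ pathVal M v := by
    intro m
    induction m using Fin.induction with
    | zero => exact h0
    | succ l ih => exact (hM.2 _ _ (v l.castSucc)).trans (max_le ih (he l))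
  exact key _

theorem IsUltra.ultraFy_eq {n : ℕ} {M : Fin n → Fin n → ℝ} (hM : IsUltra M) :
    ultraFy M = M := by
  funext i j
  apply le_antisymm
  · refine (ultraFy_le_pathVal M ![i, j]).trans ((pathVal_le_iff M _ _).2 ⟨⟨?_, ?_⟩, fun l => ?_⟩)
    · exact hM.1.2 i j
    · exact (hM.1.2 j i).trans_eq (hM.1.1 j i)
    · fin_cases l
      exact le_rfl
  · refine le_ultraFy M i j ?_
    rintro k v rfl rfl
    exact hM.le_pathVal v

theorem supDist_nonneg {n : ℕ} (A B : Fin n → Fin n → ℝ) : 0 ≤ supDist A B := by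
  apply Real.sSup_nonneg
  rintro _ ⟨i, j, rfl⟩
  exact abs_nonneg _

theorem abs_sub_le_supDist {n : ℕ} (A B : Fin n → Fin n → ℝ) (i j : Fin n) :
    |A i j - B i j| ≤ supDist A B := by
  refine le_csSup (Set.Finite.bddAbove ?_) ⟨i, j, rfl⟩
  refine (Set.finite_range fun p : Fin n × Fin n => |A p.1 p.2 - B p.1 p.2|).subset ?_
  rintro _ ⟨a, b, rfl⟩
  exact ⟨(a, b), rfl⟩

theorem supDist_le {n : ℕ} {A B : Fin n → Fin n → ℝ} {c : ℝ} (hc : 0 ≤ c)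
    (h : ∀ i j, |A i j - B i j| ≤ c) : supDist A B ≤ c := by
  refine Real.sSup_le ?_ hc
  rintro _ ⟨i, j, rfl⟩
  exact h i j

theorem supDist_triangle {n : ℕ} (A B C : Fin n → Fin n → ℝ) :
    supDist A C ≤ supDist A B + supDist B C :=
  supDist_le (add_nonneg (supDist_nonneg A B) (supDist_nonneg B C)) fun i j =>
    (abs_sub_le _ _ _).trans (add_le_add (abs_sub_le_supDist A B i j) (abs_sub_le_supDist B C i j))

theorem supDist_ultraFy_le {n : ℕ} (A B : Fin n → Fin n → ℝ) :
    supDist (ultraFy A) (ultraFy B) ≤ supDist A B := by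
  refine supDist_le (supDist_nonneg A B) fun i j => abs_sub_le_iff.2 ⟨?_, ?_⟩
  · rw [sub_le_iff_le_add']
    refine ultraFy_le_add (fun a b => ?_) i j
    linarith [(abs_sub_le_iff.1 (abs_sub_le_supDist A B a b)).1]
  · rw [sub_le_iff_le_add']
    refine ultraFy_le_add (fun a b => ?_) i j
    linarith [(abs_sub_le_iff.1 (abs_sub_le_supDist A B a b)).2]

/-- The linear interpolation between two ultra matrices, pushed through the
ultra-fication, is a geodesic for the entrywise sup distance. -/
theorem ultraFy_interpolation_geodesic {n : ℕ} (hn : 1 ≤ n)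
    (M M' : Fin n → Fin n → ℝ) (hM : IsUltra M) (hM' : IsUltra M')
    (Mlam : ℝ → Fin n → Fin n → ℝ)
    (hMlam : ∀ lam i j, Mlam lam i j = (1 - lam) * M i j + lam * M' i j) :
    (∀ lam, 0 ≤ lam → lam ≤ 1 → IsValid (Mlam lam)) ∧
    ultraFy (Mlam 0) = M ∧
    ultraFy (Mlam 1) = M' ∧
    (∀ lam mu, 0 ≤ lam → lam ≤ mu → mu ≤ 1 →
      supDist (ultraFy (Mlam lam)) (ultraFy (Mlam mu))
        = (mu - lam) * supDist M M') := by
  have h0 : Mlam 0 = M := by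
    funext i j
    simp [hMlam]
  have h1 : Mlam 1 = M' := by
    funext i j
    simp [hMlam]
  have hU0 : ultraFy (Mlam 0) = M := by rw [h0, hM.ultraFy_eq]
  have hU1 : ultraFy (Mlam 1) = M' := by rw [h1, hM'.ultraFy_eq]
  have hle : ∀ lam mu, lam ≤ mu →
      supDist (ultraFy (Mlam lam)) (ultraFy (Mlam mu)) ≤ (mu - lam) * supDist M M' := by
    intro lam mu h
    have hd : 0 ≤ mu - lam := sub_nonneg.2 h
    refine (supDist_ultraFy_le _ _).trans
      (supDist_le (mul_nonneg hd (supDist_nonneg M M')) fun i j => ?_)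
    have e : Mlam lam i j - Mlam mu i j = (mu - lam) * (M i j - M' i j) := by
      rw [hMlam, hMlam]
      ring
    rw [e, abs_mul, abs_of_nonneg hd]
    exact mul_le_mul_of_nonneg_left (abs_sub_le_supDist M M' i j) hd
  refine ⟨fun lam hl0 hl1 => ⟨fun i j => ?_, fun i j => ?_⟩, hU0, hU1,
    fun lam mu hl hlm hm => le_antisymm (hle lam mu hlm) ?_⟩
  · rw [hMlam, hMlam, hM.1.1 i j, hM'.1.1 i j]
  · rw [hMlam, hMlam]
    exact add_le_add (mul_le_mul_of_nonneg_left (hM.1.2 i j) (sub_nonneg.2 hl1))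
      (mul_le_mul_of_nonneg_left (hM'.1.2 i j) hl0)
  · have ha := hle 0 lam hl
    have hb := hle mu 1 hm
    rw [hU0] at ha
    rw [hU1] at hb
    have t1 := supDist_triangle M (ultraFy (Mlam lam)) M'
    have t2 := supDist_triangle (ultraFy (Mlam lam)) (ultraFy (Mlam mu)) M'
    linarith
end

section
/- For every valid matrix M ∈ ℝ^{n×n}, the ultra-fication is idempotent: Ũ(Ũ(M)) = Ũ(M). -/
theorem pathVal_lt_iff {n : ℕ} (M : Fin n → Fin n → ℝ) {k : ℕ} (v : Fin (k + 1) → Fin n)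
    (c : ℝ) :
    pathVal M v < c ↔ (M (v 0) (v 0) < c ∧ M (v (Fin.last k)) (v (Fin.last k)) < c) ∧
      ∀ l : Fin k, M (v l.castSucc) (v l.succ) < c := by
  simp [pathVal, Finset.fold_max_lt]

theorem diag_le_pathVal {n : ℕ} (M : Fin n → Fin n → ℝ) {k : ℕ} (v : Fin (k + 1) → Fin n) :
    M (v 0) (v 0) ≤ pathVal M v :=
  le_of_forall_gt fun _ h => ((pathVal_lt_iff M v _).1 h).1.1

/-- Reflexive-transitive reachability is witnessed by a finite sequence indexed by `Fin`. -/
theorem reflTransGen_iff_exists_fin {α : Type*} (r : α → α → Prop) (a b : α) :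
    Relation.ReflTransGen r a b ↔ ∃ (k : ℕ) (v : Fin (k + 1) → α),
      v 0 = a ∧ v (Fin.last k) = b ∧ ∀ l : Fin k, r (v l.castSucc) (v l.succ) := by
  constructor
  · intro h
    induction h using Relation.ReflTransGen.head_induction_on with
    | refl => exact ⟨0, fun _ => b, rfl, rfl, fun l => l.elim0⟩
    | @head a c hac _ ih =>
      obtain ⟨k, v, h0, hk, hv⟩ := ih
      refine ⟨k + 1, Fin.cons a v, rfl, ?_, fun l => ?_⟩
      · rw [← Fin.succ_last, Fin.cons_succ, hk]
      · refine Fin.cases ?_ (fun l => ?_) l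
        · simpa [h0] using hac
        · simpa [← Fin.succ_castSucc] using hv l
  · rintro ⟨k, v, rfl, rfl, hv⟩
    have key : ∀ l : Fin (k + 1), Relation.ReflTransGen r (v 0) (v l) := fun l => by
      induction l using Fin.induction with
      | zero => exact .refl
      | succ l ih => exact ih.tail (hv l)
    exact key _

theorem ultraFy_lt_iff {n : ℕ} (M : Fin n → Fin n → ℝ) (i j : Fin n) (c : ℝ) :
    ultraFy M i j < c ↔ M i i < c ∧ M j j < c ∧
      Relation.ReflTransGen (fun u w => M u w < c) i j := by
  have hbdd : BddBelow { x | ∃ (k : ℕ) (v : Fin (k + 1) → Fin n),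
      v 0 = i ∧ v (Fin.last k) = j ∧ x = pathVal M v } := by
    refine ⟨M i i, ?_⟩
    rintro _ ⟨k, v, rfl, -, rfl⟩
    exact diag_le_pathVal M v
  have hne : { x | ∃ (k : ℕ) (v : Fin (k + 1) → Fin n),
      v 0 = i ∧ v (Fin.last k) = j ∧ x = pathVal M v }.Nonempty :=
    ⟨_, 1, ![i, j], rfl, rfl, rfl⟩
  rw [ultraFy, csInf_lt_iff hbdd hne, reflTransGen_iff_exists_fin]
  constructor
  · rintro ⟨_, ⟨k, v, rfl, rfl, rfl⟩, h⟩
    obtain ⟨⟨h0, hk⟩, hv⟩ := (pathVal_lt_iff M v c).1 h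
    exact ⟨h0, hk, k, v, rfl, rfl, hv⟩
  · rintro ⟨h0, hk, k, v, rfl, rfl, hv⟩
    exact ⟨_, ⟨k, v, rfl, rfl, rfl⟩, (pathVal_lt_iff M v c).2 ⟨⟨h0, hk⟩, hv⟩⟩

/-- The ultra-fication is idempotent on valid matrices. -/
theorem ultraFy_idempotent {n : ℕ} (hn : 1 ≤ n)
    (M : Fin n → Fin n → ℝ) (hM : IsValid M) :
    ultraFy (ultraFy M) = ultraFy M := by
  refine funext fun i => funext fun j => eq_of_forall_gt_iff fun c => ?_
  rw [ultraFy_lt_iff]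
  constructor
  · rintro ⟨hi, hj, h⟩
    refine (ultraFy_lt_iff M i j c).2
      ⟨((ultraFy_lt_iff M i i c).1 hi).1, ((ultraFy_lt_iff M j j c).1 hj).1, ?_⟩
    induction h with
    | refl => exact .refl
    | tail _ hbc ih =>
      have hb := (ultraFy_lt_iff M _ _ c).1 hbc
      exact (ih ((ultraFy_lt_iff M _ _ c).2 ⟨hb.1, hb.1, .refl⟩)).trans hb.2.2
  · intro h
    obtain ⟨hi, hj, -⟩ := (ultraFy_lt_iff M i j c).1 h
    exact ⟨(ultraFy_lt_iff M i i c).2 ⟨hi, hi, .refl⟩,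
      (ultraFy_lt_iff M j j c).2 ⟨hj, hj, .refl⟩, .single h⟩
end
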